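/- Let A and E be real symmetric n×n matrices and set Ã := A + E. Let 1 ≤ r < n, let V ∈ O_{n,r} and Ṽ ∈ O_{n,r} be top-r orthonormal eigenbases of A and of Ã respectively, let V̂ ∈ O_{n,r} satisfy ‖VVᵀ − V̂V̂ᵀ‖₂ ≤ ε for some ε ≥ 0, and let Ŵ ∈ O_{n,n−r} satisfy ŴŴᵀ = I − V̂V̂ᵀ. Define λ̂_r := λ_r(V̂ᵀAV̂) and λ̂_{r+1} := λ₁(ŴᵀAŴ). If ‖E‖₂ < (λ_r(A) − λ_{r+1}(A))/2 and λ̂_r − λ̂_{r+1} − 3ε²ρ(A) > 0, then ‖VVᵀ − ṼṼᵀ‖₂ ≤ 2√( ε‖E‖₂² + ‖EV̂‖₂² ) / ( λ̂_r − λ̂_{r+1} − 3ε²ρ(A) ). -/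

import Mathlib

open Matrix

/-- The spectral norm (ℓ²→ℓ² operator norm) of a real matrix. -/
noncomputable def sNorm {m n : ℕ} (A : Matrix (Fin m) (Fin n) ℝ) : ℝ :=
  ‖LinearMap.toContinuousLinearMap (Matrix.toEuclideanLin A)‖

open scoped Matrix.Norms.L2Operator

lemma sNorm_eq {m n : ℕ} (A : Matrix (Fin m) (Fin n) ℝ) : sNorm A = ‖A‖ := rfl

lemma eucl_sq {n : ℕ} (x : EuclideanSpace ℝ (Fin n)) : ‖x‖ ^ 2 = x.ofLp ⬝ᵥ x.ofLp := by
  rw [EuclideanSpace.real_norm_sq_eq]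
  simp [dotProduct, sq]

lemma norm_dot {m n : ℕ} (A : Matrix (Fin m) (Fin n) ℝ) (x : Fin n → ℝ) :
    (A *ᵥ x) ⬝ᵥ (A *ᵥ x) ≤ ‖A‖ ^ 2 * (x ⬝ᵥ x) := by
  have h := Matrix.l2_opNorm_mulVec A (WithLp.toLp 2 x)
  have h2 := pow_le_pow_left₀ (norm_nonneg _) h 2
  rw [mul_pow, eucl_sq, eucl_sq] at h2
  simpa using h2

lemma norm_of_dot {m n : ℕ} (A : Matrix (Fin m) (Fin n) ℝ) (c : ℝ) (hc : 0 ≤ c)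
    (h : ∀ x : Fin n → ℝ, (A *ᵥ x) ⬝ᵥ (A *ᵥ x) ≤ c ^ 2 * (x ⬝ᵥ x)) : ‖A‖ ≤ c := by
  rw [Matrix.l2_opNorm_def]
  refine ContinuousLinearMap.opNorm_le_bound _ hc fun x => ?_
  refine (sq_le_sq₀ (norm_nonneg _) (by positivity)).1 ?_
  rw [mul_pow, eucl_sq, eucl_sq]
  simpa using h x.ofLp

lemma dot_nonneg {n : ℕ} (x : Fin n → ℝ) : 0 ≤ x ⬝ᵥ x :=
  Finset.sum_nonneg fun _ _ => mul_self_nonneg _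

lemma dot_pos {n : ℕ} (x : Fin n → ℝ) (hx : x ≠ 0) : 0 < x ⬝ᵥ x :=
  lt_of_le_of_ne (dot_nonneg x) fun h => hx (dotProduct_self_eq_zero.1 h.symm)

lemma dot_cs {n : ℕ} (x y : Fin n → ℝ) : (x ⬝ᵥ y) ^ 2 ≤ (x ⬝ᵥ x) * (y ⬝ᵥ y) := by
  have := Finset.sum_mul_sq_le_sq_mul_sq Finset.univ x y
  simpa [dotProduct, sq] using this

lemma dot_tr {m n : ℕ} (A : Matrix (Fin m) (Fin n) ℝ) (x : Fin m → ℝ) (y : Fin n → ℝ) :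
    x ⬝ᵥ (A *ᵥ y) = (Aᵀ *ᵥ x) ⬝ᵥ y := by
  rw [dotProduct_mulVec, mulVec_transpose]

lemma quad_abs {n : ℕ} (A : Matrix (Fin n) (Fin n) ℝ) (x : Fin n → ℝ) :
    |x ⬝ᵥ (A *ᵥ x)| ≤ ‖A‖ * (x ⬝ᵥ x) := by
  refine abs_le_of_sq_le_sq (?_) (mul_nonneg (norm_nonneg _) (dot_nonneg x))
  have h1 := dot_cs x (A *ᵥ x)
  have h2 := norm_dot A x
  nlinarith [mul_le_mul_of_nonneg_left h2 (dot_nonneg x)]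

lemma isom {m n : ℕ} (N : Matrix (Fin m) (Fin n) ℝ) (h : Nᵀ * N = 1) (x : Fin n → ℝ) :
    (N *ᵥ x) ⬝ᵥ (N *ᵥ x) = x ⬝ᵥ x := by
  rw [dot_tr, mulVec_mulVec, h, one_mulVec]

lemma quad_diag {n : ℕ} (U : Matrix (Fin n) (Fin n) ℝ) (μ : Fin n → ℝ) (x : Fin n → ℝ) :
    x ⬝ᵥ ((U * diagonal μ * Uᵀ) *ᵥ x) = ∑ i, μ i * ((Uᵀ *ᵥ x) i) ^ 2 := by
  rw [← mulVec_mulVec, ← mulVec_mulVec, dot_tr]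
  simp only [dotProduct, mulVec_diagonal]
  exact Finset.sum_congr rfl fun i _ => by ring

lemma dot_sum {n : ℕ} (U : Matrix (Fin n) (Fin n) ℝ) (hU : U * Uᵀ = 1) (x : Fin n → ℝ) :
    x ⬝ᵥ x = ∑ i, ((Uᵀ *ᵥ x) i) ^ 2 := by
  rw [← isom Uᵀ (by simpa using hU) x]
  simp [dotProduct, sq]

lemma quad_le {n : ℕ} (U : Matrix (Fin n) (Fin n) ℝ) (hU : U * Uᵀ = 1) (μ : Fin n → ℝ)
    (c : ℝ) (x : Fin n → ℝ) (h : ∀ i, (Uᵀ *ᵥ x) i ≠ 0 → μ i ≤ c) :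
    x ⬝ᵥ ((U * diagonal μ * Uᵀ) *ᵥ x) ≤ c * (x ⬝ᵥ x) := by
  rw [quad_diag, dot_sum U hU, Finset.mul_sum]
  refine Finset.sum_le_sum fun i _ => ?_
  by_cases hi : (Uᵀ *ᵥ x) i = 0
  · simp [hi]
  · exact mul_le_mul_of_nonneg_right (h i hi) (sq_nonneg _)

lemma quad_ge {n : ℕ} (U : Matrix (Fin n) (Fin n) ℝ) (hU : U * Uᵀ = 1) (μ : Fin n → ℝ)
    (c : ℝ) (x : Fin n → ℝ) (h : ∀ i, (Uᵀ *ᵥ x) i ≠ 0 → c ≤ μ i) :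
    c * (x ⬝ᵥ x) ≤ x ⬝ᵥ ((U * diagonal μ * Uᵀ) *ᵥ x) := by
  rw [quad_diag, dot_sum U hU, Finset.mul_sum]
  refine Finset.sum_le_sum fun i _ => ?_
  by_cases hi : (Uᵀ *ᵥ x) i = 0
  · simp [hi]
  · exact mul_le_mul_of_nonneg_right (h i hi) (sq_nonneg _)

lemma exists_ker {ι : Type} [Fintype ι] {m : ℕ} (M : Matrix ι (Fin m) ℝ)
    (h : Fintype.card ι < m) : ∃ y : Fin m → ℝ, y ≠ 0 ∧ M *ᵥ y = 0 := by
  have := LinearMap.ker_ne_bot_of_finrank_lt (f := Matrix.mulVecLin M) (by simpa using h)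
  obtain ⟨y, hy, hy0⟩ := (Submodule.ne_bot_iff _).1 this
  exact ⟨y, hy0, by simpa using hy⟩

/-- compression lower eigenvalue -/
lemma compress_lower {n m : ℕ} (A U : Matrix (Fin n) (Fin n) ℝ) (hU : U * Uᵀ = 1)
    (μ : Fin n → ℝ) (hμ : Antitone μ) (hA : A = U * diagonal μ * Uᵀ)
    (N : Matrix (Fin n) (Fin m) ℝ) (hN : Nᵀ * N = 1) (k : Fin n) (hk : k.val < m) (c : ℝ)
    (hc : ∀ y : Fin m → ℝ, c * (y ⬝ᵥ y) ≤ y ⬝ᵥ ((Nᵀ * A * N) *ᵥ y)) : c ≤ μ k := by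
  obtain ⟨y, hy0, hy⟩ := exists_ker ((Uᵀ * N).submatrix (fun i : Fin k.val => Fin.castLE k.2.le i) id)
    (by simpa using hk)
  have h1 := hc y
  have h2 : y ⬝ᵥ ((Nᵀ * A * N) *ᵥ y) = (N *ᵥ y) ⬝ᵥ (A *ᵥ (N *ᵥ y)) := by
    rw [← mulVec_mulVec, ← mulVec_mulVec, dot_tr, transpose_transpose]
  have h3 : (N *ᵥ y) ⬝ᵥ (A *ᵥ (N *ᵥ y)) ≤ μ k * ((N *ᵥ y) ⬝ᵥ (N *ᵥ y)) := by
    rw [hA]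
    refine quad_le U hU μ _ _ fun i hi => hμ ?_
    by_contra hlt
    apply hi
    have := congrFun hy ⟨i, not_le.1 hlt⟩
    rw [mulVec_mulVec]
    exact this
  rw [isom N hN] at h3
  have := dot_pos y hy0
  nlinarith

lemma compress_upper {n m : ℕ} (A U : Matrix (Fin n) (Fin n) ℝ) (hU : U * Uᵀ = 1)
    (μ : Fin n → ℝ) (hμ : Antitone μ) (hA : A = U * diagonal μ * Uᵀ)
    (N : Matrix (Fin n) (Fin m) ℝ) (hN : Nᵀ * N = 1) (k : Fin n) (hk : n - 1 - k.val < m) (c : ℝ)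
    (hc : ∀ y : Fin m → ℝ, y ⬝ᵥ ((Nᵀ * A * N) *ᵥ y) ≤ c * (y ⬝ᵥ y)) : μ k ≤ c := by
  obtain ⟨y, hy0, hy⟩ := exists_ker ((Uᵀ * N).submatrix
    (fun i : Fin (n - 1 - k.val) => (⟨k.val + 1 + i.val, by omega⟩ : Fin n)) id)
    (by simpa using hk)
  have h1 := hc y
  have h2 : y ⬝ᵥ ((Nᵀ * A * N) *ᵥ y) = (N *ᵥ y) ⬝ᵥ (A *ᵥ (N *ᵥ y)) := by
    rw [← mulVec_mulVec, ← mulVec_mulVec, dot_tr, transpose_transpose]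
  have h3 : μ k * ((N *ᵥ y) ⬝ᵥ (N *ᵥ y)) ≤ (N *ᵥ y) ⬝ᵥ (A *ᵥ (N *ᵥ y)) := by
    rw [hA]
    refine quad_ge U hU μ _ _ fun i hi => hμ ?_
    by_contra hlt
    apply hi
    have hlt' : k.val < i.val := not_le.1 hlt
    have h4 := congrFun hy ⟨i.val - (k.val + 1), by omega⟩
    rw [mulVec_mulVec]
    have h5 : (⟨k.val + 1 + (i.val - (k.val + 1)), by omega⟩ : Fin n) = i := by
      ext; simp; omega
    simp only [mulVec, submatrix, of_apply, h5] at h4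
    exact h4
  rw [isom N hN] at h3
  have := dot_pos y hy0
  nlinarith

lemma weyl {n : ℕ} (A B U W : Matrix (Fin n) (Fin n) ℝ) (hU : U * Uᵀ = 1) (hW : W * Wᵀ = 1)
    (μ μt : Fin n → ℝ) (hμ : Antitone μ) (hμt : Antitone μt) (hA : A = U * diagonal μ * Uᵀ)
    (hB : B = W * diagonal μt * Wᵀ) (k : Fin n) : μt k ≤ μ k + ‖B - A‖ := by
  let N := W.submatrix id (fun i : Fin (k.val + 1) => (Fin.castLE k.2 i : Fin n))
  have hW' : Wᵀ * W = 1 := mul_eq_one_comm.1 hW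
  have hWN : Wᵀ * N = (1 : Matrix (Fin n) (Fin n) ℝ).submatrix id
      (fun i : Fin (k.val + 1) => (Fin.castLE k.2 i : Fin n)) := by
    rw [← hW']; rfl
  have hN : Nᵀ * N = 1 := by
    have : Nᵀ * N = (Wᵀ * W).submatrix (fun i : Fin (k.val + 1) => (Fin.castLE k.2 i : Fin n))
        (fun i : Fin (k.val + 1) => (Fin.castLE k.2 i : Fin n)) := rfl
    rw [this, hW']
    exact submatrix_one _ (Fin.castLE_injective _)
  have := compress_lower A U hU μ hμ hA N hN k (Nat.lt_succ_self _) (μt k - ‖B - A‖) ?_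
  · linarith
  intro y
  have h2 : y ⬝ᵥ ((Nᵀ * A * N) *ᵥ y) = (N *ᵥ y) ⬝ᵥ (A *ᵥ (N *ᵥ y)) := by
    rw [← mulVec_mulVec, ← mulVec_mulVec, dot_tr, transpose_transpose]
  have h3 : μt k * ((N *ᵥ y) ⬝ᵥ (N *ᵥ y)) ≤ (N *ᵥ y) ⬝ᵥ (B *ᵥ (N *ᵥ y)) := by
    rw [hB]
    refine quad_ge W hW μt _ _ fun i hi => hμt ?_
    by_contra hlt
    apply hi
    rw [mulVec_mulVec, hWN]
    simp only [mulVec, dotProduct, submatrix_apply]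
    refine Finset.sum_eq_zero fun j _ => ?_
    rw [one_apply_ne, zero_mul]
    intro h
    apply hlt
    have h' : i = Fin.castLE k.2 j := h
    rw [h']
    exact Nat.le_of_lt_succ j.2
  have h4 := (abs_le.1 (quad_abs (B - A) (N *ᵥ y))).2
  rw [sub_mulVec, dotProduct_sub] at h4
  rw [isom N hN] at h3 h4
  rw [h2]
  linarith

def Jm (n r : ℕ) : Matrix (Fin n) (Fin n) ℝ := diagonal fun i => if i.val < r then 1 else 0

lemma proj_eq {n r : ℕ} (hr : 1 ≤ r) (hrn : r < n) (p : Fin n) (hp : p.val = r - 1) (A U : Matrix (Fin n) (Fin n) ℝ)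
    (hU : U * Uᵀ = 1) (μ : Fin n → ℝ) (hμ : Antitone μ) (hA : A = U * diagonal μ * Uᵀ)
    (V : Matrix (Fin n) (Fin r) ℝ) (hV : Vᵀ * V = 1)
    (hVA : A * V = V * Matrix.diagonal fun j : Fin r => μ (Fin.castLE hrn.le j))
    (hgap : μ ⟨r, hrn⟩ < μ p) :
    V * Vᵀ = U * Jm n r * Uᵀ := by
  have hU' : Uᵀ * U = 1 := mul_eq_one_comm.1 hU
  obtain ⟨M, hM⟩ : ∃ M, M = Uᵀ * V := ⟨_, rfl⟩
  have hVM : V = U * M := by rw [hM, ← Matrix.mul_assoc, hU, Matrix.one_mul]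
  have hMM : Mᵀ * M = 1 := by
    rw [hM, transpose_mul, transpose_transpose, Matrix.mul_assoc, ← Matrix.mul_assoc U, hU,
      Matrix.one_mul, hV]
  have hcomm : diagonal μ * M = M * Matrix.diagonal fun j : Fin r => μ (Fin.castLE hrn.le j) := by
    have := congrArg (Uᵀ * ·) hVA
    simp only [hA] at this
    rw [← Matrix.mul_assoc, ← Matrix.mul_assoc, ← Matrix.mul_assoc, hU', Matrix.one_mul,
      Matrix.mul_assoc, ← Matrix.mul_assoc Uᵀ V, ← hM] at this
    exact this
  have hz : ∀ i : Fin n, r ≤ i.val → ∀ j, M i j = 0 := by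
    intro i hi j
    have h1 := congrFun (congrFun hcomm i) j
    rw [diagonal_mul, mul_diagonal] at h1
    have h2 : μ i ≤ μ ⟨r, hrn⟩ := hμ hi
    have h3 : μ p ≤ μ (Fin.castLE hrn.le j) := by
      apply hμ
      show j.val ≤ p.val
      omega
    have h4 : (μ i - μ (Fin.castLE hrn.le j)) * M i j = 0 := by linarith
    rcases mul_eq_zero.1 h4 with h | h
    · linarith
    · exact h
  let M1 : Matrix (Fin r) (Fin r) ℝ := M.submatrix (Fin.castLE hrn.le) id
  have h11 : M1ᵀ * M1 = 1 := by
    rw [← hMM]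
    ext i j
    simp only [mul_apply, transpose_apply]
    refine Fintype.sum_of_injective (Fin.castLE hrn.le) (Fin.castLE_injective _) _ _ ?_ ?_
    · intro k hk
      rw [hz k _ i, zero_mul]
      by_contra h
      exact hk ⟨⟨k, not_le.1 h⟩, rfl⟩
    · intro k; rfl
  have h12 : M1 * M1ᵀ = 1 := mul_eq_one_comm.1 h11
  have hJ : M * Mᵀ = Jm n r := by
    ext i k
    by_cases hi : i.val < r
    · by_cases hk : k.val < r
      · have := congrFun (congrFun h12 ⟨i, hi⟩) ⟨k, hk⟩
        have h5 : (M * Mᵀ) i k = (M1 * M1ᵀ) ⟨i, hi⟩ ⟨k, hk⟩ := rfl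
        rw [h5, this, Jm, diagonal_apply, one_apply]
        simp [hi, Fin.ext_iff]
      · rw [mul_apply, Finset.sum_eq_zero fun j _ => by
          rw [transpose_apply, hz k (not_lt.1 hk), mul_zero], Jm, diagonal_apply_ne]
        rintro rfl; exact hk hi
    · rw [mul_apply, Finset.sum_eq_zero fun j _ => by rw [hz i (not_lt.1 hi), zero_mul], Jm,
        diagonal_apply]
      simp [hi]
  rw [← hJ, hVM, transpose_mul]
  simp only [Matrix.mul_assoc]

def Jc (n r : ℕ) : Matrix (Fin n) (Fin n) ℝ := diagonal fun i => if i.val < r then 0 else 1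

lemma J_sq (n r : ℕ) : Jm n r * Jm n r = Jm n r := by
  rw [Jm, diagonal_mul_diagonal]; congr 1; ext i; split_ifs <;> simp

lemma Jc_sq (n r : ℕ) : Jc n r * Jc n r = Jc n r := by
  rw [Jc, diagonal_mul_diagonal]; congr 1; ext i; split_ifs <;> simp

lemma Jc_J (n r : ℕ) : Jc n r * Jm n r = 0 := by
  rw [Jc, Jm, diagonal_mul_diagonal, ← diagonal_zero]; congr 1; ext i; split_ifs <;> simp

lemma J_Jc (n r : ℕ) : Jm n r * Jc n r = 0 := by
  rw [Jc, Jm, diagonal_mul_diagonal, ← diagonal_zero]; congr 1; ext i; split_ifs <;> simp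

lemma J_add (n r : ℕ) : Jm n r + Jc n r = 1 := by
  rw [Jc, Jm, diagonal_add, ← diagonal_one]; congr 1; ext i; split_ifs <;> simp

lemma J_tr (n r : ℕ) : (Jm n r)ᵀ = Jm n r := diagonal_transpose _

lemma Jc_tr (n r : ℕ) : (Jc n r)ᵀ = Jc n r := diagonal_transpose _

lemma J_orth {n : ℕ} (r : ℕ) (v w : Fin n → ℝ) : (Jm n r *ᵥ v) ⬝ᵥ (Jc n r *ᵥ w) = 0 := by
  rw [dot_tr, Jc_tr, mulVec_mulVec, Jc_J, zero_mulVec, zero_dotProduct]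

lemma J_orth2 {n : ℕ} (r : ℕ) (v w : Fin n → ℝ) :
    (Jm n r *ᵥ v + Jc n r *ᵥ w) ⬝ᵥ (Jm n r *ᵥ v + Jc n r *ᵥ w) =
     (Jm n r *ᵥ v) ⬝ᵥ (Jm n r *ᵥ v) + (Jc n r *ᵥ w) ⬝ᵥ (Jc n r *ᵥ w) := by
  rw [add_dotProduct, dotProduct_add, dotProduct_add, dotProduct_comm (Jc n r *ᵥ w) (Jm n r *ᵥ v),
    J_orth]
  ring

lemma J_pyth {n : ℕ} (r : ℕ) (v : Fin n → ℝ) :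
    (Jm n r *ᵥ v) ⬝ᵥ (Jm n r *ᵥ v) + (Jc n r *ᵥ v) ⬝ᵥ (Jc n r *ᵥ v) = v ⬝ᵥ v := by
  rw [← J_orth2, ← add_mulVec, J_add, one_mulVec]

lemma transfer {n : ℕ} (M : Matrix (Fin n) (Fin n) ℝ) (k : ℝ) (hk : 0 < k)
    (h : ∀ x, k * (x ⬝ᵥ x) ≤ (M *ᵥ x) ⬝ᵥ (M *ᵥ x)) (y : Fin n → ℝ) :
    k * (y ⬝ᵥ y) ≤ (Mᵀ *ᵥ y) ⬝ᵥ (Mᵀ *ᵥ y) := by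
  have hinj : Function.Injective M.mulVecLin := by
    rw [← LinearMap.ker_eq_bot, LinearMap.ker_eq_bot']
    intro x hx
    by_contra h0
    have h1 := h x
    have h2 : M *ᵥ x = 0 := by simpa using hx
    rw [h2, dotProduct_zero] at h1
    nlinarith [dot_pos x h0]
  obtain ⟨x, hx⟩ := LinearMap.injective_iff_surjective.1 hinj y
  have hx : M *ᵥ x = y := by simpa using hx
  have h1 := h x
  rw [hx] at h1
  have h2 := dot_cs (Mᵀ *ᵥ y) x
  rw [← dot_tr, hx] at h2
  have h3 := dot_nonneg (Mᵀ *ᵥ y)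
  rcases (dot_nonneg y).eq_or_lt with h0 | h0
  · rw [← h0]; simpa using h3
  · have h4 := mul_le_mul_of_nonneg_left h1 h3
    refine le_of_mul_le_mul_right ?_ h0
    nlinarith

lemma off_diag {n : ℕ} (r : ℕ) (G : Matrix (Fin n) (Fin n) ℝ) (hG : Gᵀ * G = 1)
    (hG' : G * Gᵀ = 1) : ‖Jm n r * G * Jc n r‖ ≤ ‖Jc n r * G * Jm n r‖ := by
  obtain ⟨z, hz⟩ : ∃ z, z = ‖Jc n r * G * Jm n r‖ := ⟨_, rfl⟩
  rw [← hz]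
  have hz0 : 0 ≤ z := hz ▸ norm_nonneg _
  by_cases h1 : 1 ≤ z
  · refine norm_of_dot _ _ hz0 fun x => ?_
    rw [← mulVec_mulVec, ← mulVec_mulVec]
    have e1 := J_pyth r (G *ᵥ Jc n r *ᵥ x)
    have e2 := J_pyth r x
    rw [isom G hG] at e1
    have hz1 : 1 ≤ z ^ 2 := by nlinarith
    nlinarith [mul_le_mul_of_nonneg_right hz1 (dot_nonneg x), dot_nonneg (Jm n r *ᵥ x), dot_nonneg (Jc n r *ᵥ G *ᵥ Jc n r *ᵥ x)]
  · have hzl : 0 < 1 - z ^ 2 := by nlinarith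
    have key := transfer (Jm n r * G * Jm n r + Jc n r) (1 - z ^ 2) hzl ?_
    · rw [← Matrix.l2_opNorm_conjTranspose, conjTranspose_eq_transpose_of_trivial]
      refine norm_of_dot _ _ hz0 fun x => ?_
      have e1 := key (Jm n r *ᵥ x)
      rw [transpose_mul, transpose_mul, J_tr, Jc_tr, ← mulVec_mulVec, ← mulVec_mulVec]
      rw [transpose_add, transpose_mul, transpose_mul, J_tr, Jc_tr, mulVec_mulVec,
        Matrix.add_mul, Jc_J, add_zero, Matrix.mul_assoc, Matrix.mul_assoc, J_sq,
        ← mulVec_mulVec, ← mulVec_mulVec] at e1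
      have e2 := J_pyth r (Gᵀ *ᵥ Jm n r *ᵥ x)
      rw [isom Gᵀ (by simpa using hG')] at e2
      have e3 := J_pyth r x
      nlinarith [dot_nonneg (Jc n r *ᵥ x), sq_nonneg z]
    · intro x
      rw [add_mulVec, ← mulVec_mulVec, ← mulVec_mulVec, J_orth2]
      have e1 := norm_dot (Jc n r * G * Jm n r) (Jm n r *ᵥ x)
      rw [mulVec_mulVec, Matrix.mul_assoc, J_sq, ← hz, ← mulVec_mulVec, ← mulVec_mulVec] at e1
      have e2 := J_pyth r (G *ᵥ Jm n r *ᵥ x)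
      rw [isom G hG] at e2
      have e3 := J_pyth r x
      nlinarith [dot_nonneg (Jc n r *ᵥ x), sq_nonneg z]

lemma comm_le {n : ℕ} (r : ℕ) (G : Matrix (Fin n) (Fin n) ℝ) (hG : Gᵀ * G = 1)
    (hG' : G * Gᵀ = 1) : ‖G * Jm n r - Jm n r * G‖ ≤ ‖Jc n r * G * Jm n r‖ := by
  have h0 := off_diag r G hG hG'
  have e0 : G * Jm n r - Jm n r * G = Jc n r * G * Jm n r - Jm n r * G * Jc n r := by
    have : Jc n r = 1 - Jm n r := by rw [← J_add n r]; abel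
    rw [this]
    noncomm_ring
  rw [e0]
  refine norm_of_dot _ _ (norm_nonneg _) fun x => ?_
  have e1 : (Jc n r * G * Jm n r - Jm n r * G * Jc n r) *ᵥ x =
      Jm n r *ᵥ (-(G *ᵥ Jc n r *ᵥ x)) + Jc n r *ᵥ (G *ᵥ Jm n r *ᵥ x) := by
    rw [sub_mulVec, ← mulVec_mulVec, ← mulVec_mulVec, ← mulVec_mulVec, ← mulVec_mulVec, mulVec_neg]
    abel
  rw [e1, J_orth2, mulVec_neg, neg_dotProduct_neg]
  have e2 := norm_dot (Jc n r * G * Jm n r) (Jm n r *ᵥ x)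
  rw [mulVec_mulVec, Matrix.mul_assoc, J_sq, ← mulVec_mulVec, ← mulVec_mulVec] at e2
  have e3 := norm_dot (Jm n r * G * Jc n r) (Jc n r *ᵥ x)
  rw [mulVec_mulVec, Matrix.mul_assoc _ (Jc n r), Jc_sq, ← mulVec_mulVec, ← mulVec_mulVec] at e3
  have e4 := J_pyth r x
  have e5 := pow_le_pow_left₀ (norm_nonneg _) h0 2
  nlinarith [mul_le_mul_of_nonneg_right e5 (dot_nonneg (Jc n r *ᵥ x))]

lemma sylv {n r : ℕ} (hr : 1 ≤ r) (hrn : r < n) (p : Fin n) (hp : p.val = r - 1) (G : Matrix (Fin n) (Fin n) ℝ)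
    (μ μt : Fin n → ℝ) (hμ : Antitone μ) (hμt : Antitone μt)
    (hgap : μt ⟨r, hrn⟩ < μ p) :
    (μ p - μt ⟨r, hrn⟩) * ‖Jc n r * G * Jm n r‖ ≤
      ‖Jc n r * (diagonal μt * G - G * diagonal μ) * Jm n r‖ := by
  obtain ⟨c, hc⟩ : ∃ c, ∀ i, 0 ≤ μt i + c := by
    refine ⟨∑ i, |μt i|, fun i => ?_⟩
    have := Finset.single_le_sum (f := fun i => |μt i|) (fun i _ => abs_nonneg _)
      (Finset.mem_univ i)
    have h2 := neg_abs_le (μt i)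
    linarith
  obtain ⟨a, ha⟩ : ∃ a, a = μ p := ⟨_, rfl⟩
  obtain ⟨b, hb⟩ : ∃ b, b = μt ⟨r, hrn⟩ := ⟨_, rfl⟩
  have hbc := hc ⟨r, hrn⟩
  rw [← ha, ← hb]
  rw [← ha, ← hb] at hgap
  rw [← hb] at hbc
  have hac : 0 < a + c := by linarith
  have hμa : ∀ i : Fin n, i.val < r → a ≤ μ i := fun i hi => by
    rw [ha]; apply hμ; show i.val ≤ p.val; omega
  let K : Matrix (Fin n) (Fin n) ℝ := diagonal fun i => if i.val < r then (μ i + c)⁻¹ else 0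
  let L : Matrix (Fin n) (Fin n) ℝ := diagonal fun i => if i.val < r then 0 else μt i + c
  have hK : ‖K‖ ≤ (a + c)⁻¹ := by
    rw [Matrix.l2_opNorm_diagonal, pi_norm_le_iff_of_nonneg (by positivity)]
    intro i
    split_ifs with hi
    · have := hμa i hi
      rw [Real.norm_of_nonneg (inv_nonneg.2 (by linarith))]
      exact inv_anti₀ hac (by linarith)
    · simpa using hac.le
  have hL : ‖L‖ ≤ b + c := by
    rw [Matrix.l2_opNorm_diagonal, pi_norm_le_iff_of_nonneg (by linarith)]
    intro i
    split_ifs with hi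
    · simpa using hbc
    · rw [Real.norm_of_nonneg (hc i)]
      have : μt i ≤ b := by rw [hb]; exact hμt (show r ≤ i.val from not_lt.1 hi)
      linarith
  obtain ⟨Z, hZ⟩ : ∃ Z, Z = Jc n r * G * Jm n r := ⟨_, rfl⟩
  obtain ⟨Q, hQ⟩ : ∃ Q, Q = Jc n r * (diagonal μt * G - G * diagonal μ) * Jm n r := ⟨_, rfl⟩
  have hZe : Z = (L * Z - Q) * K := by
    rw [hZ, hQ]
    ext i j
    simp only [K, L, Jc, Jm, mul_diagonal, diagonal_mul, Matrix.sub_apply]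
    by_cases hj : j.val < r
    · have : μ j + c ≠ 0 := by have := hμa j hj; linarith
      by_cases hi : i.val < r
      · simp [hi, hj]
      · simp only [hi, hj, if_true, if_false]
        field_simp
        ring
    · simp [hj]
  rw [← hZ, ← hQ]
  have h1 : ‖Z‖ ≤ ((b + c) * ‖Z‖ + ‖Q‖) * (a + c)⁻¹ := by
    calc ‖Z‖ = ‖(L * Z - Q) * K‖ := by rw [← hZe]
      _ ≤ ‖L * Z - Q‖ * ‖K‖ := Matrix.l2_opNorm_mul _ _
      _ ≤ (‖L‖ * ‖Z‖ + ‖Q‖) * ‖K‖ := by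
        refine mul_le_mul_of_nonneg_right ?_ (norm_nonneg _)
        exact (norm_sub_le _ _).trans (add_le_add_left (Matrix.l2_opNorm_mul _ _) _)
      _ ≤ _ := by gcongr
  rw [← div_eq_mul_inv, le_div_iff₀ hac] at h1
  linarith

lemma J_le (n r : ℕ) : ‖Jm n r‖ ≤ 1 := by
  rw [Jm, Matrix.l2_opNorm_diagonal, pi_norm_le_iff_of_nonneg (by norm_num)]
  intro i; split_ifs <;> simp

lemma Jc_le (n r : ℕ) : ‖Jc n r‖ ≤ 1 := by
  rw [Jc, Matrix.l2_opNorm_diagonal, pi_norm_le_iff_of_nonneg (by norm_num)]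
  intro i; split_ifs <;> simp

lemma iso_le {m n : ℕ} (N : Matrix (Fin m) (Fin n) ℝ) (h : Nᵀ * N = 1) : ‖N‖ ≤ 1 :=
  norm_of_dot _ _ zero_le_one fun x => by rw [isom N h]; simp

lemma tr_norm {m n : ℕ} (N : Matrix (Fin m) (Fin n) ℝ) : ‖Nᵀ‖ = ‖N‖ := by
  rw [← Matrix.l2_opNorm_conjTranspose N, conjTranspose_eq_transpose_of_trivial]

lemma mul_iso {k m n : ℕ} (X : Matrix (Fin k) (Fin m) ℝ) (N : Matrix (Fin m) (Fin n) ℝ)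
    (h : Nᵀ * N = 1) : ‖X * N‖ ≤ ‖X‖ :=
  (Matrix.l2_opNorm_mul _ _).trans (mul_le_of_le_one_right (norm_nonneg _) (iso_le N h))

lemma iso_mul {k m n : ℕ} (X : Matrix (Fin k) (Fin m) ℝ) (N : Matrix (Fin n) (Fin k) ℝ)
    (h : Nᵀ * N = 1) : ‖N * X‖ ≤ ‖X‖ :=
  (Matrix.l2_opNorm_mul _ _).trans (mul_le_of_le_one_left (norm_nonneg _) (iso_le N h))

lemma sin_theta {n r : ℕ} (hr : 1 ≤ r) (hrn : r < n) (p : Fin n) (hp : p.val = r - 1) (A E U Ut : Matrix (Fin n) (Fin n) ℝ)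
    (hU : U * Uᵀ = 1) (hUt : Ut * Utᵀ = 1)
    (μ μt : Fin n → ℝ) (hμ : Antitone μ) (hμt : Antitone μt)
    (hA : A = U * diagonal μ * Uᵀ) (hB : A + E = Ut * diagonal μt * Utᵀ)
    (hgap : μt ⟨r, hrn⟩ < μ p) :
    (μ p - μt ⟨r, hrn⟩) * ‖U * Jm n r * Uᵀ - Ut * Jm n r * Utᵀ‖ ≤
      ‖E * (U * Jm n r * Uᵀ)‖ := by
  have hU' : Uᵀ * U = 1 := mul_eq_one_comm.1 hU
  have hUt' : Utᵀ * Ut = 1 := mul_eq_one_comm.1 hUt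
  have hG : (Utᵀ * U)ᵀ * (Utᵀ * U) = 1 := by
    rw [transpose_mul, transpose_transpose, Matrix.mul_assoc, ← Matrix.mul_assoc Ut, hUt,
      Matrix.one_mul, hU']
  have hG' := mul_eq_one_comm.1 hG
  have h1 : ‖U * Jm n r * Uᵀ - Ut * Jm n r * Utᵀ‖ ≤ ‖Jc n r * (Utᵀ * U) * Jm n r‖ := by
    refine le_trans ?_ (comm_le r _ hG hG')
    have : U * Jm n r * Uᵀ - Ut * Jm n r * Utᵀ =
        Ut * ((Utᵀ * U * Jm n r - Jm n r * (Utᵀ * U)) * Uᵀ) := by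
      simp only [Matrix.sub_mul, Matrix.mul_sub, Matrix.mul_assoc, hU, Matrix.mul_one]
      rw [← Matrix.mul_assoc Ut Utᵀ, hUt, Matrix.one_mul]
    rw [this]
    exact (iso_mul _ _ hUt').trans (mul_iso _ _ (by simpa using hU))
  have h2 := sylv hr hrn p hp (Utᵀ * U) μ μt hμ hμt hgap
  have h3 : diagonal μt * (Utᵀ * U) - Utᵀ * U * diagonal μ = Utᵀ * E * U := by
    have hE : E = Ut * diagonal μt * Utᵀ - U * diagonal μ * Uᵀ := by rw [← hA, ← hB]; abel
    rw [hE]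
    simp only [Matrix.sub_mul, Matrix.mul_sub, Matrix.mul_assoc, hU', Matrix.mul_one]
    rw [← Matrix.mul_assoc Utᵀ Ut, hUt', Matrix.one_mul]
  rw [h3] at h2
  have h4 : ‖Jc n r * (Utᵀ * E * U) * Jm n r‖ ≤ ‖E * (U * Jm n r * Uᵀ)‖ := by
    have : Jc n r * (Utᵀ * E * U) * Jm n r = Jc n r * (Utᵀ * ((E * (U * Jm n r * Uᵀ)) * U)) := by
      simp only [Matrix.mul_assoc, hU', Matrix.mul_one]
    rw [this]
    refine (Matrix.l2_opNorm_mul _ _).trans ?_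
    refine (mul_le_of_le_one_left (norm_nonneg _) (Jc_le n r)).trans ?_
    exact (iso_mul _ _ (by simpa using hUt)).trans (mul_iso _ _ hU')
  refine le_trans ?_ (h2.trans h4)
  exact mul_le_mul_of_nonneg_left h1 (by linarith)

lemma EV_bound {n r : ℕ} (E : Matrix (Fin n) (Fin n) ℝ) (hE : Eᵀ = E)
    (V Vh : Matrix (Fin n) (Fin r) ℝ) (hV : Vᵀ * V = 1) (ε : ℝ)
    (hd : ‖V * Vᵀ - Vh * Vhᵀ‖ ≤ ε) :
    ‖E * (V * Vᵀ)‖ ^ 2 ≤ ε * ‖E‖ ^ 2 + ‖E * Vh‖ ^ 2 := by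
  have hid : (V * Vᵀ) * (V * Vᵀ) = V * Vᵀ := by
    rw [Matrix.mul_assoc, ← Matrix.mul_assoc Vᵀ, hV, Matrix.one_mul]
  have h1 : ‖E * (V * Vᵀ)‖ ^ 2 = ‖E * (V * Vᵀ) * E‖ := by
    have h := Matrix.l2_opNorm_conjTranspose_mul_self ((E * (V * Vᵀ))ᵀ)
    rw [conjTranspose_eq_transpose_of_trivial, transpose_transpose, tr_norm] at h
    rw [sq, ← h]
    congr 1
    rw [transpose_mul, transpose_mul, transpose_transpose, hE, Matrix.mul_assoc,
      ← Matrix.mul_assoc (V * Vᵀ), hid, ← Matrix.mul_assoc]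
  have h2 : E * (V * Vᵀ) * E = E * (V * Vᵀ - Vh * Vhᵀ) * E + (E * Vh) * (E * Vh)ᵀ := by
    rw [transpose_mul, hE]
    simp only [Matrix.sub_mul, Matrix.mul_sub, Matrix.mul_assoc]
    abel
  rw [h1, h2]
  refine (norm_add_le _ _).trans (add_le_add ?_ ?_)
  · calc _ ≤ ‖E * (V * Vᵀ - Vh * Vhᵀ)‖ * ‖E‖ := Matrix.l2_opNorm_mul _ _
      _ ≤ (‖E‖ * ε) * ‖E‖ := by
        refine mul_le_mul_of_nonneg_right ?_ (norm_nonneg _)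
        exact (Matrix.l2_opNorm_mul _ _).trans (mul_le_mul_of_nonneg_left hd (norm_nonneg _))
      _ = _ := by ring
  · refine (Matrix.l2_opNorm_mul _ _).trans ?_
    rw [tr_norm, sq]

/-- Computable Davis–Kahan proxy for the incremental subspace-tracking algorithm:
`μ` (resp. `μt`) lists the eigenvalues of the symmetric matrices `A` (resp. `Ã = A + E`)
in decreasing order, `V` and `Vt` are top-`r` orthonormal eigenbases of `A` and `A + E`,
`Vh` is `ε`-close to `V`, `Wh Whᵀ = I − Vh Vhᵀ`, and `λ̂_r = λ_r(Vhᵀ A Vh)` (the smallest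
eigenvalue `ν ⟨r−1⟩` of `Vhᵀ A Vh`), `λ̂_{r+1} = λ₁(Whᵀ A Wh)` (the largest eigenvalue
`η ⟨0⟩` of `Whᵀ A Wh`), with `ρ(A) = ⨆ j, |μ j|`. -/
theorem davis_kahan_computable_proxy
    (n r : ℕ) (hr : 1 ≤ r) (hrn : r < n)
    (A E : Matrix (Fin n) (Fin n) ℝ) (hA : Aᵀ = A) (hE : Eᵀ = E)
    (μ : Fin n → ℝ) (hμmono : Antitone μ)
    (U : Matrix (Fin n) (Fin n) ℝ) (hU : U * Uᵀ = 1)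
    (hdecomp : A = U * Matrix.diagonal μ * Uᵀ)
    (μt : Fin n → ℝ) (hμtmono : Antitone μt)
    (Ut : Matrix (Fin n) (Fin n) ℝ) (hUt : Ut * Utᵀ = 1)
    (hdecompt : A + E = Ut * Matrix.diagonal μt * Utᵀ)
    (V : Matrix (Fin n) (Fin r) ℝ) (hV : Vᵀ * V = 1)
    (hVA : A * V = V * Matrix.diagonal fun j : Fin r => μ (Fin.castLE hrn.le j))
    (Vt : Matrix (Fin n) (Fin r) ℝ) (hVt : Vtᵀ * Vt = 1)
    (hVtA : (A + E) * Vt = Vt * Matrix.diagonal fun j : Fin r => μt (Fin.castLE hrn.le j))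
    (ε : ℝ) (hε : 0 ≤ ε)
    (Vh : Matrix (Fin n) (Fin r) ℝ) (hVh : Vhᵀ * Vh = 1)
    (hdist : sNorm (V * Vᵀ - Vh * Vhᵀ) ≤ ε)
    (Wh : Matrix (Fin n) (Fin (n - r)) ℝ) (hWh : Whᵀ * Wh = 1)
    (hWhproj : Wh * Whᵀ = 1 - Vh * Vhᵀ)
    (ν : Fin r → ℝ) (hνmono : Antitone ν)
    (Pv : Matrix (Fin r) (Fin r) ℝ) (hPv : Pv * Pvᵀ = 1)
    (hVAV : Vhᵀ * A * Vh = Pv * Matrix.diagonal ν * Pvᵀ)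
    (η : Fin (n - r) → ℝ) (hηmono : Antitone η)
    (Pw : Matrix (Fin (n - r)) (Fin (n - r)) ℝ) (hPw : Pw * Pwᵀ = 1)
    (hWAW : Whᵀ * A * Wh = Pw * Matrix.diagonal η * Pwᵀ)
    (hEsmall : sNorm E < (μ ⟨r - 1, by omega⟩ - μ ⟨r, hrn⟩) / 2)
    (hdenom : 0 < ν ⟨r - 1, by omega⟩ - η ⟨0, by omega⟩ - 3 * ε ^ 2 * (⨆ j : Fin n, |μ j|)) :
    sNorm (V * Vᵀ - Vt * Vtᵀ) ≤
      2 * Real.sqrt (ε * sNorm E ^ 2 + sNorm (E * Vh) ^ 2) /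
        (ν ⟨r - 1, by omega⟩ - η ⟨0, by omega⟩ - 3 * ε ^ 2 * (⨆ j : Fin n, |μ j|)) := by
  have hρ : 0 ≤ ⨆ j : Fin n, |μ j| := Real.iSup_nonneg fun j => abs_nonneg _
  simp only [sNorm_eq] at *
  have hν : ν ⟨r - 1, by omega⟩ ≤ μ ⟨r - 1, by omega⟩ := by
    refine compress_lower A U hU μ hμmono hdecomp Vh hVh ⟨r - 1, by omega⟩ (by simp; omega) _ ?_
    intro y
    rw [hVAV]
    refine quad_ge Pv hPv ν _ y fun i _ => hνmono ?_
    show i.val ≤ r - 1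
    omega
  have hη : μ ⟨r, hrn⟩ ≤ η ⟨0, by omega⟩ := by
    refine compress_upper A U hU μ hμmono hdecomp Wh hWh ⟨r, hrn⟩ (by simp; omega) _ ?_
    intro y
    rw [hWAW]
    refine quad_le Pw hPw η _ y fun i _ => hηmono ?_
    show 0 ≤ i.val
    omega
  have hw1 := weyl A (A + E) U Ut hU hUt μ μt hμmono hμtmono hdecomp hdecompt ⟨r, hrn⟩
  have hw2 := weyl (A + E) A Ut U hUt hU μt μ hμtmono hμmono hdecompt hdecomp ⟨r - 1, by omega⟩
  rw [show A + E - A = E by abel] at hw1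
  rw [show A - (A + E) = -E by abel, norm_neg] at hw2
  have hE0 := norm_nonneg E
  have hP := proj_eq hr hrn ⟨r - 1, by omega⟩ rfl A U hU μ hμmono hdecomp V hV hVA (by linarith)
  have hPt := proj_eq hr hrn ⟨r - 1, by omega⟩ rfl (A + E) Ut hUt μt hμtmono hdecompt Vt hVt hVtA (by linarith)
  have hs := sin_theta hr hrn ⟨r - 1, by omega⟩ rfl A E U Ut hU hUt μ μt hμmono hμtmono hdecomp hdecompt (by linarith)
  rw [← hP, ← hPt] at hs
  have hb := Real.le_sqrt_of_sq_le (EV_bound E hE V Vh hV ε hdist)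
  rw [le_div_iff₀ hdenom]
  have h0 := norm_nonneg (V * Vᵀ - Vt * Vtᵀ)
  have hρ' : 0 ≤ 3 * ε ^ 2 * ⨆ j : Fin n, |μ j| := by positivity
  have hfin : ν ⟨r - 1, by omega⟩ - η ⟨0, by omega⟩ - 3 * ε ^ 2 * (⨆ j : Fin n, |μ j|) ≤
      2 * (μ ⟨r - 1, by omega⟩ - μt ⟨r, hrn⟩) := by linarith
  have := mul_le_mul_of_nonneg_left hfin h0
  nlinarith
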